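/- Let K be an algebraically closed field with a surjective valuation deg : Kˣ → ℝ, and let I ⊆ K[x₁,…,xₙ] be an ideal. Then there exists a finite subset G ⊆ I such that the tropical variety T(I) (the intersection of the tropical hypersurfaces T(trop(f)) over all nonzero f ∈ I) equals the intersection of the finitely many tropical hypersurfaces T(trop(f)) for f ∈ G. In other words, every tropical variety is a finite intersection of tropical hypersurfaces. -/

import Mathlib

open scoped Classical

open MvPolynomial

/-- A surjective real valuation on a field `K`, recorded as a degree function `deg : K → ℝ`
(the value at `0` is irrelevant): `deg(ab) = deg a + deg b`, `deg(a+b) ≥ min (deg a) (deg b)`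
whenever all three elements are nonzero, and every real number is the degree of some nonzero
element of `K`. -/
structure ValData (K : Type*) [Field K] where
  deg : K → ℝ
  deg_mul : ∀ a b : K, a ≠ 0 → b ≠ 0 → deg (a * b) = deg a + deg b
  deg_add : ∀ a b : K, a ≠ 0 → b ≠ 0 → a + b ≠ 0 → min (deg a) (deg b) ≤ deg (a + b)
  surj : ∀ r : ℝ, ∃ a : K, a ≠ 0 ∧ deg a = r

variable {K : Type*} [Field K]

/-- The `w`-weight of the term of `f` with exponent vector `a`:
`deg(c_a) + ⟨a, w⟩` where `c_a` is the corresponding coefficient. -/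
noncomputable def ValData.termWeight (V : ValData K) {n : ℕ} (w : Fin n → ℝ)
    (f : MvPolynomial (Fin n) K) (a : Fin n →₀ ℕ) : ℝ :=
  V.deg (f.coeff a) + a.sum fun i e => (e : ℝ) * w i

/-- The tropical hypersurface `T(trop f)` of a (nonzero) polynomial `f`: the set of `w ∈ ℝⁿ`
at which the minimum of the `w`-weights of the terms of `f` is attained at least twice. -/
def ValData.tropHyp (V : ValData K) {n : ℕ} (f : MvPolynomial (Fin n) K) :
    Set (Fin n → ℝ) :=
  { w | ∃ a ∈ f.support, ∃ b ∈ f.support, a ≠ b ∧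
      V.termWeight w f a = V.termWeight w f b ∧
      ∀ c ∈ f.support, V.termWeight w f a ≤ V.termWeight w f c }


section TropAux

set_option linter.unusedSectionVars false

variable {σ : Type} [Fintype σ]

/-- weight of exponent -/
noncomputable def tWt (u : σ → ℝ) (a : σ →₀ ℕ) : ℝ := ∑ i, (a i : ℝ) * u i

lemma tWt_add (u : σ → ℝ) (a b : σ →₀ ℕ) : tWt u (a + b) = tWt u a + tWt u b := by
  simp [tWt, add_mul, Finset.sum_add_distrib]

lemma tWt_zero (u : σ → ℝ) : tWt u 0 = 0 := by simp [tWt]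

noncomputable def tTw (V : ValData K) (u : σ → ℝ) (f : MvPolynomial σ K) (a : σ →₀ ℕ) : ℝ :=
  V.deg (f.coeff a) + tWt u a

def UMin (V : ValData K) (u : σ → ℝ) (f : MvPolynomial σ K) (a : σ →₀ ℕ) : Prop :=
  f.coeff a ≠ 0 ∧ ∀ b, f.coeff b ≠ 0 → b ≠ a → tTw V u f a < tTw V u f b

lemma ValData.deg_one (V : ValData K) : V.deg 1 = 0 := by
  have := V.deg_mul 1 1 one_ne_zero one_ne_zero
  simp at this
  exact this

lemma ValData.deg_neg_one (V : ValData K) : V.deg (-1) = 0 := by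
  have := V.deg_mul (-1) (-1) (by simp) (by simp)
  simp [V.deg_one] at this
  linarith

lemma ValData.deg_neg (V : ValData K) (x : K) (hx : x ≠ 0) : V.deg (-x) = V.deg x := by
  have := V.deg_mul (-1) x (by simp) hx
  simpa [V.deg_neg_one] using this

/-- elements of valuation bigger than `r`. -/
def VGt (V : ValData K) (r : ℝ) (x : K) : Prop := x ≠ 0 → r < V.deg x

lemma VGt.add {V : ValData K} {r : ℝ} {x y : K} (hx : VGt V r x) (hy : VGt V r y) :
    VGt V r (x + y) := by
  intro h
  by_cases h1 : x = 0
  · subst h1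
    simp only [zero_add] at h ⊢
    exact hy h
  by_cases h2 : y = 0
  · subst h2
    simp only [add_zero] at h ⊢
    exact hx h
  exact lt_of_lt_of_le (lt_min (hx h1) (hy h2)) (V.deg_add x y h1 h2 h)

lemma VGt.neg {V : ValData K} {r : ℝ} {x : K} (hx : VGt V r x) : VGt V r (-x) := by
  intro h
  have h' : x ≠ 0 := by simpa using h
  rw [V.deg_neg x h']
  exact hx h'

lemma VGt.sum {V : ValData K} {r : ℝ} {ι : Type*} (s : Finset ι) (x : ι → K)
    (h : ∀ i ∈ s, VGt V r (x i)) : VGt V r (∑ i ∈ s, x i) := by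
  induction s using Finset.induction_on with
  | empty => intro h; simp at h
  | insert a s ha ih =>
    rw [Finset.sum_insert ha]
    exact (h a (by simp)).add (ih fun i hi => h i (by simp [hi]))

lemma VGt.deg_add_eq {V : ValData K} {x y : K} (hx : x ≠ 0) (hy : VGt V (V.deg x) y) :
    x + y ≠ 0 ∧ V.deg (x + y) = V.deg x := by
  have h0 : x + y ≠ 0 := by
    intro h
    have hyx : y = -x := by linear_combination h
    have := hy (by rw [hyx]; simpa using hx)
    rw [hyx, V.deg_neg x hx] at this
    exact lt_irrefl _ this
  refine ⟨h0, ?_⟩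
  by_cases hy0 : y = 0
  · simp [hy0]
  have h1 := V.deg_add x y hx hy0 h0
  have h2 := hy hy0
  rw [min_eq_left h2.le] at h1
  refine le_antisymm ?_ h1
  by_contra hlt
  push Not at hlt
  have : VGt V (V.deg x) (x + y + -y) := VGt.add (fun _ => hlt) hy.neg
  have := this (by simpa using hx)
  simp at this

/-- ordering key -/
noncomputable def tKey (m : MonomialOrder σ) (r : ℝ) (a : σ →₀ ℕ) : ℝ ×ₗ (m.syn)ᵒᵈ :=
  toLex (r, OrderDual.toDual (m.toSyn a))

lemma tKey_le (m : MonomialOrder σ) {r s : ℝ} {a b : σ →₀ ℕ} :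
    tKey m r a ≤ tKey m s b ↔ r < s ∨ r = s ∧ m.toSyn b ≤ m.toSyn a := by
  simp [tKey, Prod.Lex.le_iff]

lemma tKey_lt (m : MonomialOrder σ) {r s : ℝ} {a b : σ →₀ ℕ} :
    tKey m r a < tKey m s b ↔ r < s ∨ r = s ∧ m.toSyn b < m.toSyn a := by
  simp [tKey, Prod.Lex.lt_iff]

lemma tKey_lt_of_le_ne (m : MonomialOrder σ) {r s : ℝ} {a b : σ →₀ ℕ}
    (h : tKey m r a ≤ tKey m s b) (hab : a ≠ b) : tKey m r a < tKey m s b := by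
  refine lt_of_le_of_ne h fun h' => hab ?_
  simpa [tKey] using congrArg (fun x => (ofLex x).2) h'

def TLead (V : ValData K) (m : MonomialOrder σ) (u : σ → ℝ) (f : MvPolynomial σ K)
    (a : σ →₀ ℕ) : Prop :=
  f.coeff a ≠ 0 ∧ ∀ b, f.coeff b ≠ 0 → tKey m (tTw V u f a) a ≤ tKey m (tTw V u f b) b

lemma exists_TLead (V : ValData K) (m : MonomialOrder σ) (u : σ → ℝ) (f : MvPolynomial σ K)
    (hf : f ≠ 0) : ∃ a, TLead V m u f a := by
  obtain ⟨a, ha, h⟩ := Finset.exists_min_image f.support (fun a => tKey m (tTw V u f a) a)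
    (by simpa using hf)
  exact ⟨a, by simpa using ha, fun b hb => h b (by simpa using hb)⟩

lemma TLead_zero_iff (V : ValData K) (m : MonomialOrder σ) (u : σ → ℝ) (f : MvPolynomial σ K) :
    TLead V m u f 0 ↔ UMin V u f 0 := by
  refine and_congr_right fun h0 => forall_congr' fun b => forall_congr' fun hb => ?_
  rw [tKey_le]
  by_cases hb0 : b = 0
  · simp [hb0]
  · have : ¬ (m.toSyn b ≤ m.toSyn 0) := by
      intro h
      have h2 : m.toSyn 0 ≤ m.toSyn b := m.toSyn_monotone (by simp)
      exact hb0 (m.toSyn.injective (le_antisymm h h2))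
    simp only [this, and_false, or_false, ne_eq, hb0, not_false_eq_true, forall_const]

lemma TLead.mul {V : ValData K} {m : MonomialOrder σ} {u : σ → ℝ} {f : MvPolynomial σ K}
    {a : σ →₀ ℕ} (h : TLead V m u f a) (b : σ →₀ ℕ) :
    TLead V m u (monomial b 1 * f) (b + a) := by
  have hc : ∀ c, (monomial b 1 * f).coeff (b + c) = f.coeff c := by
    intro c; rw [coeff_monomial_mul]; simp
  refine ⟨by rw [hc]; exact h.1, fun c hcc => ?_⟩
  have hbc : b ≤ c := by
    by_contra hn
    rw [coeff_monomial_mul', if_neg hn] at hcc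
    exact hcc rfl
  obtain ⟨d, rfl⟩ := le_iff_exists_add.1 hbc
  rw [hc] at hcc
  have := h.2 d hcc
  rw [tKey_le] at this ⊢
  simp only [tTw, hc, tWt_add, map_add] at this ⊢
  rcases this with h | ⟨h1, h2⟩
  · left; linarith
  · right; exact ⟨by linarith, by gcongr⟩

/-- The truncated ideal. -/
noncomputable def tTr (I : Ideal (MvPolynomial σ K)) (d : ℕ) : Submodule K (MvPolynomial σ K) :=
  I.restrictScalars K ⊓ restrictTotalDegree σ K d

lemma mem_tTr {I : Ideal (MvPolynomial σ K)} {d : ℕ} {f : MvPolynomial σ K} :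
    f ∈ tTr I d ↔ f ∈ I ∧ f.totalDegree ≤ d := by
  simp [tTr, mem_restrictTotalDegree]

instance (I : Ideal (MvPolynomial σ K)) (d : ℕ) : FiniteDimensional K (tTr I d) :=
  Submodule.finiteDimensional_of_le (S₂ := restrictTotalDegree σ K d) inf_le_right

def tLeads (V : ValData K) (m : MonomialOrder σ) (I : Ideal (MvPolynomial σ K)) (u : σ → ℝ)
    (d : ℕ) : Set (σ →₀ ℕ) := {a | ∃ f ∈ tTr I d, TLead V m u f a}

lemma tLeads_degree {V : ValData K} {m : MonomialOrder σ} {I : Ideal (MvPolynomial σ K)}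
    {u : σ → ℝ} {d : ℕ} {a : σ →₀ ℕ} (h : a ∈ tLeads V m I u d) : a.degree ≤ d := by
  obtain ⟨f, hf, ha⟩ := h
  exact (le_totalDegree (by simpa using ha.1)).trans (mem_tTr.1 hf).2

lemma tLeads_finite (V : ValData K) (m : MonomialOrder σ) (I : Ideal (MvPolynomial σ K))
    (u : σ → ℝ) (d : ℕ) : (tLeads V m I u d).Finite :=
  (Finsupp.finite_of_degree_le d).subset fun _ h => tLeads_degree h

lemma tLeads_add {V : ValData K} {m : MonomialOrder σ} {I : Ideal (MvPolynomial σ K)}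
    {u : σ → ℝ} {d : ℕ} {a : σ →₀ ℕ} (h : a ∈ tLeads V m I u d) (b : σ →₀ ℕ) (e : ℕ)
    (he : b.degree + d ≤ e) : b + a ∈ tLeads V m I u e := by
  obtain ⟨f, hf, ha⟩ := h
  rw [mem_tTr] at hf
  refine ⟨monomial b 1 * f, mem_tTr.2 ⟨I.mul_mem_left _ hf.1, ?_⟩, ha.mul b⟩
  refine (totalDegree_mul _ _).trans ?_
  have : (monomial b (1 : K)).totalDegree = b.degree := by
    rw [totalDegree_monomial _ one_ne_zero]; rfl
  omega

lemma tLeads_linInd (V : ValData K) (m : MonomialOrder σ) (u : σ → ℝ) {ι : Type*}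
    (f : ι → MvPolynomial σ K) (a : ι → σ →₀ ℕ) (ha : Function.Injective a)
    (h : ∀ i, TLead V m u (f i) (a i)) : LinearIndependent K f := by
  rw [linearIndependent_iff']
  intro s c hsum
  by_contra hne
  push Not at hne
  obtain ⟨i0, hi0, hci0⟩ := hne
  obtain ⟨i, hi, hmin⟩ := Finset.exists_min_image (s.filter fun i => c i ≠ 0)
    (fun i => tKey m (V.deg (c i) + tTw V u (f i) (a i)) (a i)) ⟨i0, by simp [hi0, hci0]⟩
  simp only [Finset.mem_filter] at hi hmin
  have hco := congrArg (coeff (a i)) hsum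
  rw [coeff_sum, ← Finset.add_sum_erase s _ hi.1] at hco
  simp only [coeff_smul, smul_eq_mul, coeff_zero] at hco
  have hx0 : c i * coeff (a i) (f i) ≠ 0 := mul_ne_zero hi.2 (h i).1
  refine (VGt.deg_add_eq (V := V) hx0 (VGt.sum _ _ ?_)).1 hco
  intro j hj hj0
  rw [Finset.mem_erase] at hj
  have hcj : c j ≠ 0 := left_ne_zero_of_mul hj0
  have hfj : coeff (a i) (f j) ≠ 0 := right_ne_zero_of_mul hj0
  have h1 := tKey_lt_of_le_ne m (hmin j ⟨hj.2, hcj⟩) (fun h => hj.1 (ha h.symm))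
  have h2 := (h j).2 _ hfj
  have h3 : tKey m (V.deg (c j) + tTw V u (f j) (a j)) (a j) ≤
      tKey m (V.deg (c j) + tTw V u (f j) (a i)) (a i) := by
    rw [tKey_le] at h2 ⊢
    simpa using h2
  have h4 := lt_of_lt_of_le h1 h3
  rw [tKey_lt] at h4
  rw [V.deg_mul _ _ hi.2 (h i).1, V.deg_mul _ _ hcj hfj]
  simp only [lt_irrefl, and_false, or_false, tTw] at h4
  linarith

lemma tLeads_ncard (V : ValData K) (m : MonomialOrder σ) (I : Ideal (MvPolynomial σ K))
    (u : σ → ℝ) (d : ℕ) : (tLeads V m I u d).ncard = Module.finrank K (tTr I d) := by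
  have : Fintype (tLeads V m I u d) := (tLeads_finite V m I u d).fintype
  rw [← Nat.card_coe_set_eq, Nat.card_eq_fintype_card]
  apply le_antisymm
  · choose f hf hl using fun a : tLeads V m I u d => a.2
    have hli := tLeads_linInd V m u f (fun a => a.1) Subtype.val_injective hl
    have : LinearIndependent K (fun a => (⟨f a, hf a⟩ : tTr I d)) := by
      apply LinearIndependent.of_comp (tTr I d).subtype
      exact hli
    exact this.fintype_card_le_finrank
  · let φ : tTr I d →ₗ[K] (tLeads V m I u d → K) :=
      (LinearMap.pi fun a => lcoeff K a.1) ∘ₗ (tTr I d).subtype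
    have hφ : Function.Injective φ := by
      rw [← LinearMap.ker_eq_bot, LinearMap.ker_eq_bot']
      rintro ⟨f, hf⟩ h0
      by_contra hne
      obtain ⟨a, ha⟩ := exists_TLead V m u f (fun h => hne (by simp [h]))
      exact ha.1 (congrFun h0 ⟨a, f, hf, ha⟩)
    simpa using LinearMap.finrank_le_finrank_of_injective hφ

theorem tBound (V : ValData K) (I : Ideal (MvPolynomial σ K)) :
    ∃ D, ∀ u, (∃ f ∈ I, UMin V u f 0) → ∃ f ∈ tTr I D, UMin V u f 0 := by
  let _ : LinearOrder σ := LinearOrder.lift' (Fintype.equivFin σ) (Fintype.equivFin σ).injective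
  let m : MonomialOrder σ := MonomialOrder.lex
  by_contra hcon
  push Not at hcon
  choose u hu hn using hcon
  let U : Ultrafilter ℕ := Filter.hyperfilter ℕ
  let P : Set ((σ →₀ ℕ) × ℕ) :=
    {p | ∀ᶠ D in (U : Filter ℕ), p.1 ∈ tLeads V m I (u D) (p.1.degree + p.2)}
  have hfin : {p | Minimal (· ∈ P) p}.Finite :=
    WellQuasiOrderedLE.finite_of_isAntichain (setOfPred_minimal_antichain _)
  have hev : ∀ᶠ D in (U : Filter ℕ), ∀ p ∈ {p | Minimal (· ∈ P) p},
      p.1 ∈ tLeads V m I (u D) (p.1.degree + p.2) :=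
    (Filter.eventually_all_finite hfin).2 fun p hp => hp.1
  obtain ⟨D, hD⟩ := hev.exists
  have hPD : ∀ p ∈ P, p.1 ∈ tLeads V m I (u D) (p.1.degree + p.2) := by
    intro p hp
    obtain ⟨q, hqp, hq⟩ := exists_minimal_le_of_wellFoundedLT (· ∈ P) p hp
    have h1 := hD q hq
    obtain ⟨b, hb⟩ := le_iff_exists_add'.1 hqp.1
    rw [hb]
    apply tLeads_add h1
    have := hqp.2
    rw [map_add]
    omega
  obtain ⟨f, hfI, hf⟩ := hu D
  set d := f.totalDegree with hd
  have h0 : (0 : σ →₀ ℕ) ∈ tLeads V m I (u D) d :=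
    ⟨f, mem_tTr.2 ⟨hfI, le_rfl⟩, (TLead_zero_iff V m (u D) f).2 hf⟩
  let Q : Set (σ →₀ ℕ) := {a | ∀ᶠ D in (U : Filter ℕ), a ∈ tLeads V m I (u D) d}
  have hQD : Q ⊆ tLeads V m I (u D) d := by
    intro a ha
    obtain ⟨D', hD'⟩ := ha.exists
    have hdeg := tLeads_degree hD'
    have := hPD (a, d - a.degree) (by
      simp only [P, Set.mem_ofPred_eq]
      rw [Nat.add_sub_cancel' hdeg]; exact ha)
    simp only [Nat.add_sub_cancel' hdeg] at this
    exact this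
  have hev2 : ∀ᶠ D' in (U : Filter ℕ), ∀ a ∈ {a : σ →₀ ℕ | a.degree ≤ d},
      (a ∈ tLeads V m I (u D') d → a ∈ Q) := by
    refine (Filter.eventually_all_finite (Finsupp.finite_of_degree_le d)).2 fun a _ => ?_
    by_cases haQ : a ∈ Q
    · exact Filter.Eventually.of_forall fun _ _ => haQ
    · have : ∀ᶠ D' in (U : Filter ℕ), ¬ (a ∈ tLeads V m I (u D') d) :=
        Ultrafilter.eventually_not.2 haQ
      exact this.mono fun _ h h' => absurd h' h
  obtain ⟨D', hD'⟩ := hev2.exists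
  have hsub : tLeads V m I (u D') d ⊆ tLeads V m I (u D) d := fun a ha =>
    hQD (hD' a (tLeads_degree ha) ha)
  have heq := Set.eq_of_subset_of_ncard_le hsub
    (by rw [tLeads_ncard, tLeads_ncard]) (tLeads_finite V m I (u D) d)
  have h0Q : (0 : σ →₀ ℕ) ∈ Q := by
    rw [← heq] at h0
    exact hD' 0 (tLeads_degree h0) h0
  have hge : ∀ᶠ E in (U : Filter ℕ), d ≤ E := by
    have : (U : Filter ℕ) ≤ Filter.atTop := Nat.hyperfilter_le_atTop
    exact this (Filter.eventually_ge_atTop d)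
  obtain ⟨E, ⟨g, hg, hgl⟩, hE⟩ := (Filter.Eventually.and h0Q hge).exists
  rw [mem_tTr] at hg
  exact hn E g (mem_tTr.2 ⟨hg.1, hg.2.trans hE⟩) ((TLead_zero_iff V m (u E) g).1 hgl)

def TMin (W : Submodule K (MvPolynomial σ K)) (g : MvPolynomial σ K) : Prop :=
  g ∈ W ∧ g ≠ 0 ∧ ∀ h ∈ W, h.support ⊂ g.support → h = 0

lemma tCirc_aux (V : ValData K) (W : Submodule K (MvPolynomial σ K)) (u : σ → ℝ) (a : σ →₀ ℕ)
    (k : ℕ) : ∀ f ∈ W, f.support.card = k → UMin V u f a → ∃ g, TMin W g ∧ UMin V u g a := by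
  induction k using Nat.strong_induction_on with
  | _ k ih =>
  intro f hf hk hu
  by_cases hm : TMin W f
  · exact ⟨f, hm, hu⟩
  have hf0 : f ≠ 0 := by rintro rfl; exact hu.1 (by simp)
  have : ∃ g ∈ W, g.support ⊂ f.support ∧ g ≠ 0 := by
    by_contra hcon
    push Not at hcon
    exact hm ⟨hf, hf0, hcon⟩
  obtain ⟨g, hg, hgs, hg0⟩ := this
  by_cases hgu : UMin V u g a
  · exact ih _ (by rw [← hk]; exact Finset.card_lt_card hgs) g hg rfl hgu
  have : ∃ b, b ≠ a ∧ g.coeff b ≠ 0 ∧ ∀ c, g.coeff c ≠ 0 → tTw V u g b ≤ tTw V u g c := by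
    obtain ⟨b, hb, hmin⟩ := Finset.exists_min_image g.support (fun a => tTw V u g a)
      (by simpa using hg0)
    rw [mem_support_iff] at hb
    by_cases hba : b = a
    · subst hba
      by_contra hcon
      push Not at hcon
      refine hgu ⟨hb, fun c hc hcb => ?_⟩
      obtain ⟨e, he, he'⟩ := hcon c hcb hc
      exact (hmin e (by simpa using he)).trans_lt he'
    · exact ⟨b, hba, hb, fun c hc => hmin c (by simpa using hc)⟩
  obtain ⟨b, hba, hb, hmin⟩ := this
  have hfb : f.coeff b ≠ 0 := by
    have := hgs.1 (mem_support_iff.2 hb)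
    simpa using this
  set l := - (f.coeff b / g.coeff b) with hl
  have hl0 : l ≠ 0 := by simp [hl, hb, hfb]
  have hlb : V.deg l + V.deg (g.coeff b) = V.deg (f.coeff b) := by
    rw [← V.deg_mul _ _ hl0 hb]
    have : l * g.coeff b = - f.coeff b := by rw [hl]; field_simp
    rw [this, V.deg_neg _ hfb]
  have hco : ∀ c, (f + l • g).coeff c = f.coeff c + l * g.coeff c := by intro c; simp
  have hsub : (f + l • g).support ⊆ f.support := by
    intro c hc
    rw [mem_support_iff, hco] at hc
    by_contra hcf
    have hcg : c ∉ g.support := fun h => hcf (hgs.1 h)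
    rw [notMem_support_iff] at hcf hcg
    simp [hcf, hcg] at hc
  have hss : (f + l • g).support ⊂ f.support := by
    refine ⟨hsub, fun h => ?_⟩
    have := h (mem_support_iff.2 hfb)
    rw [mem_support_iff, hco] at this
    apply this
    rw [hl]; field_simp; ring
  have hfab := hu.2 b hfb hba
  -- lower bound for terms of l • g
  have hlg : ∀ c, VGt V (tTw V u f a - tWt u c) (l * g.coeff c) := by
    intro c hc
    have hgc : g.coeff c ≠ 0 := right_ne_zero_of_mul hc
    rw [V.deg_mul _ _ hl0 hgc]
    have := hmin c hgc
    simp only [tTw] at this hfab ⊢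
    linarith
  have hA := VGt.deg_add_eq (V := V) hu.1 (y := l * g.coeff a) (by
    have := hlg a
    simpa [tTw] using this)
  refine ih _ (by rw [← hk]; exact Finset.card_lt_card hss) (f + l • g)
    (W.add_mem hf (W.smul_mem _ hg)) rfl ⟨by rw [hco]; exact hA.1, fun c hc hca => ?_⟩
  have h1 : tTw V u (f + l • g) a = tTw V u f a := by
    simp only [tTw, hco, hA.2]
  have h2 : VGt V (tTw V u f a - tWt u c) (f.coeff c + l * g.coeff c) := by
    refine VGt.add (fun hfc => ?_) (hlg c)
    have := hu.2 c hfc hca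
    simp only [tTw] at this ⊢
    linarith
  rw [h1]
  rw [hco] at hc
  have := h2 hc
  simp only [tTw, hco] at this ⊢
  linarith

lemma UMin.smul {V : ValData K} {u : σ → ℝ} {a : σ →₀ ℕ} {f : MvPolynomial σ K}
    (h : UMin V u f a) {l : K} (hl : l ≠ 0) : UMin V u (l • f) a := by
  refine ⟨by simpa [hl] using h.1, fun b hb hba => ?_⟩
  have hb' : f.coeff b ≠ 0 := by simpa [hl] using hb
  have := h.2 b hb' hba
  simp only [tTw, coeff_smul, smul_eq_mul] at this ⊢
  rw [V.deg_mul _ _ hl h.1, V.deg_mul _ _ hl hb']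
  linarith

lemma TMin.prop {W : Submodule K (MvPolynomial σ K)} {g h : MvPolynomial σ K} (hg : TMin W g)
    (hh : TMin W h) (hs : g.support = h.support) : ∃ l : K, l ≠ 0 ∧ g = l • h := by
  obtain ⟨b, hb⟩ : h.support.Nonempty := by simpa using hh.2.1
  have hb' : b ∈ g.support := hs ▸ hb
  rw [mem_support_iff] at hb hb'
  refine ⟨g.coeff b / h.coeff b, div_ne_zero hb' hb, ?_⟩
  have hmem : g - (g.coeff b / h.coeff b) • h ∈ W := W.sub_mem hg.1 (W.smul_mem _ hh.1)
  have := hg.2.2 _ hmem ⟨?_, fun hsub => ?_⟩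
  · exact sub_eq_zero.1 this
  · intro c hc
    by_contra hcg
    have hch : c ∉ h.support := hs ▸ hcg
    rw [notMem_support_iff] at hcg hch
    simp [hcg, hch] at hc
  · have := hsub (mem_support_iff.2 hb')
    simp [hb] at this

theorem tCirc (V : ValData K) (W : Submodule K (MvPolynomial σ K)) (B : Finset (σ →₀ ℕ))
    (hB : ∀ f ∈ W, f.support ⊆ B) : ∃ G : Finset (MvPolynomial σ K), (∀ g ∈ G, g ∈ W) ∧
      ∀ u a, ∀ f ∈ W, UMin V u f a → ∃ g ∈ G, UMin V u g a := by
  let r : Finset (σ →₀ ℕ) → MvPolynomial σ K := fun T =>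
    if h : ∃ g, TMin W g ∧ g.support = T then h.choose else 0
  refine ⟨B.powerset.image r, ?_, ?_⟩
  · intro g hg
    obtain ⟨T, _, rfl⟩ := Finset.mem_image.1 hg
    simp only [r]
    split_ifs with h
    · exact h.choose_spec.1.1
    · exact W.zero_mem
  · intro u a f hf hu
    obtain ⟨g, hg, hgu⟩ := tCirc_aux V W u a _ f hf rfl hu
    have h : ∃ g', TMin W g' ∧ g'.support = g.support := ⟨g, hg, rfl⟩
    refine ⟨r g.support, Finset.mem_image.2 ⟨_, Finset.mem_powerset.2 (hB g hg.1), rfl⟩, ?_⟩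
    have hr : r g.support = h.choose := by simp only [r]; rw [dif_pos h]
    obtain ⟨l, hl, hlg⟩ := TMin.prop h.choose_spec.1 hg h.choose_spec.2
    rw [hr, hlg]
    exact hgu.smul hl

theorem tFin (V : ValData K) (I : Ideal (MvPolynomial σ K)) :
    ∃ G : Finset (MvPolynomial σ K), (∀ g ∈ G, g ∈ I) ∧
      ∀ u, (∃ f ∈ I, UMin V u f 0) → ∃ g ∈ G, UMin V u g 0 := by
  obtain ⟨D, hD⟩ := tBound V I
  obtain ⟨G, hG, h⟩ := tCirc V (tTr I D) (Finsupp.finite_of_degree_le D).toFinset (by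
    intro f hf a ha
    simp only [Set.Finite.mem_toFinset, Set.mem_ofPred_eq]
    exact (le_totalDegree ha).trans (mem_tTr.1 hf).2)
  refine ⟨G, fun g hg => (mem_tTr.1 (hG g hg)).1, fun u hu => ?_⟩
  obtain ⟨f, hf, hfu⟩ := hD u hu
  exact h u 0 f hf hfu

end TropAux

section TropLaurent

variable {n : ℕ}

noncomputable abbrev tProd (K : Type*) [Field K] (n : ℕ) : MvPolynomial (Fin n) K := ∏ i, X i

noncomputable abbrev TLoc (K : Type*) [Field K] (n : ℕ) := Localization.Away (tProd K n)

lemma tX_unit (i : Fin n) :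
    IsUnit (algebraMap (MvPolynomial (Fin n) K) (TLoc K n) (X i)) := by
  have h : IsUnit (algebraMap (MvPolynomial (Fin n) K) (TLoc K n) (tProd K n)) :=
    IsLocalization.Away.algebraMap_isUnit _
  exact isUnit_of_dvd_unit (map_dvd _ (Finset.dvd_prod_of_mem _ (Finset.mem_univ i))) h

lemma tLoc_inj : Function.Injective (algebraMap (MvPolynomial (Fin n) K) (TLoc K n)) := by
  apply IsLocalization.injective (M := Submonoid.powers (tProd K n))
  apply powers_le_nonZeroDivisors_of_noZeroDivisors
  exact Finset.prod_ne_zero_iff.2 fun i _ => X_ne_zero i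

noncomputable def tInv (K : Type*) [Field K] {n : ℕ} (i : Fin n) : TLoc K n :=
  ↑((tX_unit (K := K) i).unit⁻¹)

lemma tInv_mul (i : Fin n) :
    tInv K i * algebraMap (MvPolynomial (Fin n) K) (TLoc K n) (X i) = 1 := by
  simp [tInv]

noncomputable def tPhi (K : Type*) [Field K] (n : ℕ) :
    MvPolynomial (Fin n ⊕ Fin n) K →ₐ[K] TLoc K n :=
  aeval (Sum.elim (fun i => algebraMap (MvPolynomial (Fin n) K) (TLoc K n) (X i)) (tInv K))

/-- components of an exponent. -/
noncomputable def tL (p : Fin n ⊕ Fin n →₀ ℕ) : Fin n →₀ ℕ :=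
  Finsupp.equivFunOnFinite.symm fun i => p (Sum.inl i)

noncomputable def tR (p : Fin n ⊕ Fin n →₀ ℕ) : Fin n →₀ ℕ :=
  Finsupp.equivFunOnFinite.symm fun i => p (Sum.inr i)

lemma tPhi_monomial (p : Fin n ⊕ Fin n →₀ ℕ) (c : K) :
    tPhi K n (monomial p c) * algebraMap (MvPolynomial (Fin n) K) (TLoc K n) (monomial (tR p) 1) =
      algebraMap (MvPolynomial (Fin n) K) (TLoc K n) (monomial (tL p) c) := by
  have h1 : ∀ (q : Fin n →₀ ℕ) (c : K), algebraMap (MvPolynomial (Fin n) K) (TLoc K n)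
      (monomial q c) = algebraMap K (TLoc K n) c *
        ∏ i, algebraMap (MvPolynomial (Fin n) K) (TLoc K n) (X i) ^ q i := by
    intro q c
    rw [monomial_eq, Finsupp.prod_fintype _ _ (by simp), map_mul, map_prod]
    simp only [map_pow]
    congr 1
  rw [h1, h1, tPhi, aeval_monomial, Finsupp.prod_fintype _ _ (by simp), Fintype.prod_sum_type]
  simp only [Sum.elim_inl, Sum.elim_inr, map_one, one_mul, tL, tR,
    Finsupp.equivFunOnFinite_symm_apply_apply]
  rw [mul_assoc, mul_assoc, ← Finset.prod_mul_distrib]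
  simp only [← mul_pow, tInv_mul, one_pow, Finset.prod_const_one, mul_one]

lemma tPhi_monomial' (p : Fin n ⊕ Fin n →₀ ℕ) (c : K) (a b : Fin n →₀ ℕ)
    (hle : tR p ≤ a) (h : tL p + a = b + tR p) :
    tPhi K n (monomial p c) * algebraMap (MvPolynomial (Fin n) K) (TLoc K n) (monomial a 1) =
      algebraMap (MvPolynomial (Fin n) K) (TLoc K n) (monomial b c) := by
  obtain ⟨r, rfl⟩ := le_iff_exists_add.1 hle
  have hb : b = tL p + r := by
    apply add_right_cancel (b := tR p)
    rw [← h]; abel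
  have e1 : (monomial (tR p + r) (1 : K)) = monomial (tR p) 1 * monomial r 1 := by
    simp [monomial_mul]
  have e2 : (monomial (tL p + r) c) = monomial (tL p) c * monomial r 1 := by
    simp [monomial_mul]
  rw [hb, e1, e2, map_mul, map_mul, ← mul_assoc, tPhi_monomial]

noncomputable def tI' (I : Ideal (MvPolynomial (Fin n) K)) :
    Ideal (MvPolynomial (Fin n ⊕ Fin n) K) :=
  Ideal.comap (tPhi K n) (Ideal.map (algebraMap (MvPolynomial (Fin n) K) (TLoc K n)) I)

def tU (w : Fin n → ℝ) : Fin n ⊕ Fin n → ℝ := Sum.elim w (fun i => - w i)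

lemma tWt_tU (w : Fin n → ℝ) (p : Fin n ⊕ Fin n →₀ ℕ) :
    tWt (tU w) p = tWt w (tL p) - tWt w (tR p) := by
  simp [tWt, tU, tL, tR, Fintype.sum_sum_type, sub_eq_add_neg]

noncomputable def tIota (a c : Fin n →₀ ℕ) : Fin n ⊕ Fin n →₀ ℕ :=
  Finsupp.equivFunOnFinite.symm (Sum.elim (fun i => c i - a i) (fun i => a i - c i))

lemma tIota_key (a c : Fin n →₀ ℕ) : tL (tIota a c) + a = c + tR (tIota a c) := by
  ext i
  simp [tL, tR, tIota]
  omega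

lemma tIota_le (a c : Fin n →₀ ℕ) : tR (tIota a c) ≤ a := by
  intro i
  simp [tR, tIota]

lemma tIota_inj (a : Fin n →₀ ℕ) : Function.Injective (tIota a) := by
  intro c d h
  have h1 := tIota_key a c
  rw [h, tIota_key a d] at h1
  exact (add_right_cancel h1).symm

lemma tIota_self (a : Fin n →₀ ℕ) : tIota a a = 0 := by
  ext i
  cases i <;> simp [tIota]

lemma tForward (V : ValData K) (I : Ideal (MvPolynomial (Fin n) K)) (w : Fin n → ℝ)
    (f : MvPolynomial (Fin n) K) (hf : f ∈ I) (a : Fin n →₀ ℕ) (h : UMin V w f a) :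
    ∃ g ∈ tI' I, UMin V (tU w) g 0 := by
  let g : MvPolynomial (Fin n ⊕ Fin n) K := ∑ c ∈ f.support, monomial (tIota a c) (f.coeff c)
  have hg1 : ∀ c, g.coeff (tIota a c) = f.coeff c := by
    intro c
    simp only [g, coeff_sum, coeff_monomial, (tIota_inj a).eq_iff]
    simp only [Finset.sum_ite_eq', mem_support_iff]
    split_ifs with h
    · rfl
    · exact (not_not.1 h).symm
  have hg2 : ∀ p, g.coeff p ≠ 0 → ∃ c, tIota a c = p := by
    intro p hp
    by_contra hcon
    push Not at hcon
    apply hp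
    simp only [g, coeff_sum, coeff_monomial]
    exact Finset.sum_eq_zero fun c _ => if_neg (hcon c)
  refine ⟨g, ?_, ?_⟩
  · rw [tI', Ideal.mem_comap]
    have e : tPhi K n g * algebraMap (MvPolynomial (Fin n) K) (TLoc K n) (monomial a 1) =
        algebraMap (MvPolynomial (Fin n) K) (TLoc K n) f := by
      conv_rhs => rw [f.as_sum]
      simp only [g, map_sum, Finset.sum_mul]
      exact Finset.sum_congr rfl fun c _ =>
        tPhi_monomial' _ _ _ _ (tIota_le a c) (tIota_key a c)
    have hu : IsUnit (algebraMap (MvPolynomial (Fin n) K) (TLoc K n) (monomial a 1)) := by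
      rw [monomial_eq, Finsupp.prod_fintype _ _ (by simp), map_mul, map_prod]
      simp only [map_one, one_mul, map_pow]
      exact (Finset.univ.prod_induction _ _ (fun _ _ => IsUnit.mul) isUnit_one
        fun i _ => (tX_unit i).pow _)
    rw [← Ideal.mul_unit_mem_iff_mem _ hu, e]
    exact Ideal.mem_map_of_mem _ hf
  · have hw : ∀ c, tWt (tU w) (tIota a c) = tWt w c - tWt w a := by
      intro c
      rw [tWt_tU]
      have := congrArg (tWt w) (tIota_key a c)
      rw [tWt_add, tWt_add] at this
      linarith
    rw [← tIota_self a]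
    refine ⟨by rw [hg1]; exact h.1, fun p hp hpa => ?_⟩
    obtain ⟨c, rfl⟩ := hg2 p hp
    rw [hg1] at hp
    have := h.2 c hp (fun hca => hpa (by rw [hca]))
    simp only [tTw, hg1, hw] at this ⊢
    linarith

lemma tBackward (V : ValData K) (I : Ideal (MvPolynomial (Fin n) K))
    (g : MvPolynomial (Fin n ⊕ Fin n) K) (hg : g ∈ tI' I) :
    ∃ f ∈ I, ∀ w, UMin V (tU w) g 0 → ∃ a, UMin V w f a := by
  rw [tI', Ideal.mem_comap, IsLocalization.mem_map_algebraMap_iff (Submonoid.powers (tProd K n))]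
    at hg
  obtain ⟨⟨⟨f0, hf0⟩, ⟨s, ⟨k, rfl⟩⟩⟩, hfs⟩ := hg
  simp only at hfs
  let m := g.totalDegree + k
  let M : Fin n →₀ ℕ := Finsupp.equivFunOnFinite.symm fun _ => m
  have hM : tProd K n ^ m = monomial M 1 := by
    rw [monomial_eq, Finsupp.prod_fintype _ _ (by simp), tProd, ← Finset.prod_pow]
    simp [M]
  let κ : (Fin n ⊕ Fin n →₀ ℕ) → (Fin n →₀ ℕ) := fun p => tL p + (M - tR p)
  have hle : ∀ p ∈ g.support, tR p ≤ M := by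
    intro p hp i
    have h1 : p (Sum.inr i) ≤ p.degree := Finsupp.le_degree _ _
    have h2 : p.degree ≤ g.totalDegree := le_totalDegree hp
    simp [tR, M, m]
    omega
  have hκ : ∀ p ∈ g.support, tL p + M = κ p + tR p := by
    intro p hp
    simp only [κ]
    rw [add_assoc, tsub_add_cancel_of_le (hle p hp)]
  let f := f0 * tProd K n ^ g.totalDegree
  have hf : f = ∑ p ∈ g.support, monomial (κ p) (g.coeff p) := by
    apply tLoc_inj
    have : algebraMap (MvPolynomial (Fin n) K) (TLoc K n) f =
        tPhi K n g * algebraMap (MvPolynomial (Fin n) K) (TLoc K n) (monomial M 1) := by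
      rw [← hM]
      simp only [f, m]
      rw [map_mul, ← hfs, pow_add, map_mul]
      ring
    rw [this]
    conv_lhs => rw [g.as_sum]
    rw [map_sum, map_sum, Finset.sum_mul]
    exact Finset.sum_congr rfl fun p hp => tPhi_monomial' _ _ _ _ (hle p hp) (hκ p hp)
  refine ⟨f, I.mul_mem_right _ hf0, fun w hw => ⟨M, ?_⟩⟩
  have h0s : (0 : Fin n ⊕ Fin n →₀ ℕ) ∈ g.support := mem_support_iff.2 hw.1
  have hκ0 : κ 0 = M := by
    have := hκ 0 h0s
    have h1 : tL (0 : Fin n ⊕ Fin n →₀ ℕ) = 0 := by ext; simp [tL]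
    have h2 : tR (0 : Fin n ⊕ Fin n →₀ ℕ) = 0 := by ext; simp [tR]
    rw [h1, h2] at this
    simpa using this.symm
  have hwt : ∀ p ∈ g.support, tWt (tU w) p = tWt w (κ p) - tWt w M := by
    intro p hp
    rw [tWt_tU]
    have := congrArg (tWt w) (hκ p hp)
    rw [tWt_add, tWt_add] at this
    linarith
  have hrest : ∀ c, VGt V (V.deg (g.coeff 0) + tWt w M - tWt w c)
      (∑ p ∈ g.support.erase 0, if κ p = c then g.coeff p else 0) := by
    intro c
    refine VGt.sum _ _ fun p hp hne => ?_
    rw [Finset.mem_erase] at hp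
    split_ifs at hne ⊢ with hc
    · have h1 := hw.2 p (mem_support_iff.1 hp.2) hp.1
      simp only [tTw, hwt p hp.2, tWt_zero] at h1
      rw [hc] at h1
      linarith
    · exact absurd rfl hne
  have hco : ∀ c, f.coeff c = (if κ 0 = c then g.coeff 0 else 0) +
      ∑ p ∈ g.support.erase 0, if κ p = c then g.coeff p else 0 := by
    intro c
    rw [hf, coeff_sum, Finset.add_sum_erase _ (fun p => if κ p = c then g.coeff p else 0) h0s]
    simp only [coeff_monomial]
  have hA := VGt.deg_add_eq (V := V) hw.1
    (y := ∑ p ∈ g.support.erase 0, if κ p = M then g.coeff p else 0) (by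
      simpa using hrest M)
  have hcM := hco M
  rw [if_pos hκ0] at hcM
  refine ⟨by rw [hcM]; exact hA.1, fun c hc hcM' => ?_⟩
  have hcc := hco c
  rw [if_neg (fun h => hcM' (by rw [← h, hκ0])), zero_add] at hcc
  have h3 := hrest c
  rw [← hcc] at h3
  have h4 := h3 hc
  simp only [tTw]
  rw [hcM, hA.2]
  linarith

lemma tTermWeight (V : ValData K) (w : Fin n → ℝ) (f : MvPolynomial (Fin n) K)
    (a : Fin n →₀ ℕ) : V.termWeight w f a = tTw V w f a := by
  rw [ValData.termWeight, tTw, tWt, Finsupp.sum_fintype _ _ (by simp)]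

lemma not_mem_tropHyp_iff (V : ValData K) (w : Fin n → ℝ) (f : MvPolynomial (Fin n) K)
    (hf : f ≠ 0) : w ∉ V.tropHyp f ↔ ∃ a, UMin V w f a := by
  constructor
  · intro h
    obtain ⟨a, ha, hmin⟩ := Finset.exists_min_image f.support (fun a => tTw V w f a)
      (by simpa using hf)
    refine ⟨a, mem_support_iff.1 ha, fun b hb hba => ?_⟩
    have hb' := mem_support_iff.2 hb
    refine lt_of_le_of_ne (hmin b hb') fun heq => h ⟨a, ha, b, hb', hba.symm, ?_, ?_⟩
    · simpa only [tTermWeight] using heq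
    · intro c hc
      simpa only [tTermWeight] using hmin c hc
  · rintro ⟨a, ha, hmin⟩ ⟨b, hb, c, hc, hbc, heq, hle⟩
    simp only [tTermWeight] at heq hle
    have h1 := hle a (mem_support_iff.2 ha)
    by_cases hba : b = a
    · have := hmin c (mem_support_iff.1 hc) (fun h => hbc (hba.trans h.symm))
      rw [← heq, hba] at this
      exact lt_irrefl _ this
    · exact absurd h1 (not_le.2 (hmin b (mem_support_iff.1 hb) hba))

end TropLaurent

/-- Finiteness in tropical geometry: for an ideal `I` in the polynomial ring
over an algebraically closed field with a surjective real valuation, the tropical variety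
`T(I) = ⋂_{0 ≠ f ∈ I} T(trop f)` is the intersection of finitely many of the tropical
hypersurfaces `T(trop f)`, `f ∈ I`. -/
theorem tropical_variety_finite_intersection {K : Type} [Field K] [IsAlgClosed K]
    (V : ValData K) (n : ℕ) (I : Ideal (MvPolynomial (Fin n) K)) :
    ∃ G : Finset (MvPolynomial (Fin n) K), (↑G : Set (MvPolynomial (Fin n) K)) ⊆ I ∧
      (∀ f ∈ G, f ≠ 0) ∧
      { w | ∀ f ∈ I, f ≠ 0 → w ∈ V.tropHyp f } = ⋂ f ∈ G, V.tropHyp f := by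
  obtain ⟨G', hG', hfin⟩ := tFin V (tI' I)
  choose! F hFI hF using fun g hg => tBackward V I g hg
  refine ⟨(G'.image F).filter (· ≠ 0), ?_, ?_, ?_⟩
  · intro f hf
    simp only [Finset.coe_filter, Finset.mem_image] at hf
    obtain ⟨⟨g, hg, rfl⟩, _⟩ := hf
    exact hFI g (hG' g hg)
  · intro f hf
    exact (Finset.mem_filter.1 hf).2
  · ext w
    simp only [Set.mem_iInter]
    constructor
    · intro h f hf
      obtain ⟨hf1, hf0⟩ := Finset.mem_filter.1 hf
      obtain ⟨g, hg, rfl⟩ := Finset.mem_image.1 hf1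
      exact h _ (hFI g (hG' g hg)) hf0
    · intro h f hf hf0
      by_contra hw
      obtain ⟨a, ha⟩ := (not_mem_tropHyp_iff V w f hf0).1 hw
      obtain ⟨g, hg, hgu⟩ := hfin (tU w) (tForward V I w f hf a ha)
      obtain ⟨b, hb⟩ := hF g (hG' g hg) w hgu
      have hne : F g ≠ 0 := by
        intro h0
        apply hb.1
        rw [h0, coeff_zero]
      exact (not_mem_tropHyp_iff V w (F g) hne).2 ⟨b, hb⟩
        (h (F g) (Finset.mem_filter.2 ⟨Finset.mem_image_of_mem _ hg, hne⟩))
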